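/- Let k, p be positive integers and x, z ∈ S_∞ with x ≤_k z and x(p) = z(p). Set k' := k if k < p and k' := k−1 otherwise. Then x/_p ≤_{k'} z/_p; the map v ↦ v/_p is an order isomorphism from [x,z]_k := {v : x ≤_k v ≤_k z} onto [x/_p, z/_p]_{k'} := {v : x/_p ≤_{k'} v ≤_{k'} z/_p} (a bijection with v ≤_k v' iff v/_p ≤_{k'} v'/_p); and z∘x^{-1} = ε_{x(p),x(p)}( (z/_p)∘(x/_p)^{-1} ). -/

import Mathlib

/-- `S_∞`: a permutation of the positive integers lies in `S_∞` iff it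
fixes all but finitely many integers. -/
def finSupp (w : Equiv.Perm ℕ+) : Prop := {i : ℕ+ | w i ≠ i}.Finite

/-- The length `ℓ(w) = #{(i,j) : i < j and w(i) > w(j)}`. -/
noncomputable def len (w : Equiv.Perm ℕ+) : ℕ :=
  {p : ℕ+ × ℕ+ | p.1 < p.2 ∧ w p.2 < w p.1}.ncard

/-- Cover relation of the `k`-Bruhat order: `w = u∘(a,b)` with `a ≤ k < b`
and `ℓ(w) = ℓ(u) + 1`. -/
def kBruhatCover (k : ℕ) (u w : Equiv.Perm ℕ+) : Prop :=
  ∃ a b : ℕ+, (a : ℕ) ≤ k ∧ k < (b : ℕ) ∧ w = u * Equiv.swap a b ∧ len w = len u + 1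

/-- The `k`-Bruhat order `≤_k`: reflexive–transitive closure of the cover relation. -/
def kBruhatLE (k : ℕ) : Equiv.Perm ℕ+ → Equiv.Perm ℕ+ → Prop :=
  Relation.ReflTransGen (kBruhatCover k)

/-- `isEps p q w w'` says `w' = ε_{p,q}(w)`. -/
def isEps (p q : ℕ+) (w w' : Equiv.Perm ℕ+) : Prop :=
  (∀ j : ℕ+, j < p → (w j < q → w' j = w j) ∧ (q ≤ w j → w' j = w j + 1)) ∧
  w' p = q ∧
  (∀ j : ℕ+, p < j → (w (j - 1) < q → w' j = w (j - 1)) ∧ (q ≤ w (j - 1) → w' j = w (j - 1) + 1))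

/-- `isDel p x x'` says `x' = x/_p` (delete the `p`-th row and `x(p)`-th column). -/
def isDel (p : ℕ+) (x x' : Equiv.Perm ℕ+) : Prop :=
  (∀ j : ℕ+, j < p → (x j < x p → x' j = x j) ∧ (x p < x j → x' j = x j - 1)) ∧
  (∀ j : ℕ+, p ≤ j → (x (j + 1) < x p → x' j = x (j + 1)) ∧ (x p < x (j + 1) → x' j = x (j + 1) - 1))

/-- The set of inversions of a permutation. -/
def inversions (w : Equiv.Perm ℕ+) : Set (ℕ+ × ℕ+) :=
  {p : ℕ+ × ℕ+ | p.1 < p.2 ∧ w p.2 < w p.1}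

/-- The increasing enumeration of the positive integers different from `p`. -/
def skip (p i : ℕ+) : ℕ+ := if i < p then i else i + 1

lemma coe_skip (p i : ℕ+) : (skip p i : ℕ) = if (i : ℕ) < p then (i : ℕ) else i + 1 := by
  unfold skip
  simp only [PNat.coe_lt_coe]
  split_ifs <;> simp

lemma skip_strictMono (p : ℕ+) : StrictMono (skip p) := by
  intro i j h
  rw [← PNat.coe_lt_coe] at h ⊢
  rw [coe_skip, coe_skip]
  split_ifs <;> omega

lemma skip_ne (p i : ℕ+) : skip p i ≠ p := by
  intro h
  have h' := congrArg PNat.val h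
  change (skip p i : ℕ) = p at h'
  rw [coe_skip] at h'
  split_ifs at h' <;> omega

lemma skip_sub_one {p j : ℕ+} (h : p < j) : skip p (j - 1) = j := by
  rw [← PNat.coe_lt_coe] at h
  have hp := p.pos
  apply PNat.eq
  have h1 : (1 : ℕ+) < j := by rw [← PNat.coe_lt_coe, PNat.one_coe]; omega
  rw [coe_skip, PNat.sub_coe, if_pos h1, PNat.one_coe]
  split_ifs <;> omega

lemma skip_of_lt {p j : ℕ+} (h : j < p) : skip p j = j := if_pos h

lemma skip_of_le {p j : ℕ+} (h : p ≤ j) : skip p j = j + 1 := if_neg h.not_gt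

lemma exists_skip_eq {p j : ℕ+} (h : j ≠ p) : ∃ i, skip p i = j := by
  rcases lt_or_gt_of_ne h with h | h
  · exact ⟨j, skip_of_lt h⟩
  · exact ⟨j - 1, skip_sub_one h⟩

lemma coe_skip_le_iff {k k' : ℕ} {p : ℕ+} (hk' : k' = if k < (p : ℕ) then k else k - 1)
    (i : ℕ+) : (skip p i : ℕ) ≤ k ↔ (i : ℕ) ≤ k' := by
  have hp := p.pos
  rw [coe_skip, hk']
  split_ifs <;> omega

lemma isDel.apply_skip {p : ℕ+} {x x' : Equiv.Perm ℕ+} (h : isDel p x x') (i : ℕ+) :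
    x (skip p i) = skip (x p) (x' i) := by
  have hne : x (skip p i) ≠ x p := fun e => skip_ne p i (x.injective e)
  rcases lt_or_ge i p with hi | hi
  · rw [skip_of_lt hi] at hne ⊢
    rcases lt_or_gt_of_ne hne with hlt | hlt
    · rw [(h.1 i hi).1 hlt, skip_of_lt hlt]
    · rw [(h.1 i hi).2 hlt, skip_sub_one hlt]
  · rw [skip_of_le hi] at hne ⊢
    rcases lt_or_gt_of_ne hne with hlt | hlt
    · rw [(h.2 i hi).1 hlt, skip_of_lt hlt]
    · rw [(h.2 i hi).2 hlt, skip_sub_one hlt]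

lemma isEps.apply_skip {p q : ℕ+} {w w' : Equiv.Perm ℕ+} (h : isEps p q w w') (i : ℕ+) :
    w' (skip p i) = skip q (w i) := by
  rcases lt_or_ge i p with hi | hi
  · rw [skip_of_lt hi]
    rcases lt_or_ge (w i) q with hlt | hlt
    · rw [(h.1 i hi).1 hlt, skip_of_lt hlt]
    · rw [(h.1 i hi).2 hlt, skip_of_le hlt]
  · rw [skip_of_le hi]
    have hpi : p < i + 1 := PNat.lt_add_one_iff.2 hi
    have e : i + 1 - 1 = i := by
      apply (skip_strictMono p).injective
      rw [skip_sub_one hpi, skip_of_le hi]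
    have h2 := h.2.2 (i + 1) hpi
    rw [e] at h2
    rcases lt_or_ge (w i) q with hlt | hlt
    · rw [h2.1 hlt, skip_of_lt hlt]
    · rw [h2.2 hlt, skip_of_le hlt]

lemma finite_inversions {x : Equiv.Perm ℕ+} (hx : finSupp x) : (inversions x).Finite := by
  obtain ⟨N, hN⟩ := hx.bddAbove
  have hfix : ∀ i, N < i → x i = i := fun i hi => by
    by_contra h
    exact absurd (hN h) hi.not_ge
  refine ((Set.finite_Iic N).prod (Set.finite_Iic N)).subset ?_
  rintro ⟨i, j⟩ ⟨hij, hxij⟩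
  dsimp only at hij hxij
  have hj : j ≤ N := by
    by_contra! h
    rw [hfix j h] at hxij
    have := x.injective (hfix (x i) (h.trans hxij))
    rw [this] at hxij
    exact hij.asymm hxij
  exact ⟨hij.le.trans hj, hj⟩

/-- The map comparing the inversions of `u` with those of `u * Equiv.swap a b`. -/
def swapPair (a b : ℕ+) (q : ℕ+ × ℕ+) : ℕ+ × ℕ+ :=
  if Equiv.swap a b q.1 < Equiv.swap a b q.2 then
    (Equiv.swap a b q.1, Equiv.swap a b q.2) else q

lemma swapPair_swapPair {a b : ℕ+} {q : ℕ+ × ℕ+} (hq : q.1 < q.2) :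
    swapPair a b (swapPair a b q) = q := by
  by_cases h : Equiv.swap a b q.1 < Equiv.swap a b q.2
  · simp [swapPair, h, hq]
  · simp [swapPair, h]

lemma swapPair_injOn (a b : ℕ+) (u : Equiv.Perm ℕ+) :
    Set.InjOn (swapPair a b) (inversions u) := by
  intro q hq r hr h
  rw [← swapPair_swapPair (a := a) (b := b) hq.1, h, swapPair_swapPair hr.1]

lemma swap_lt_swap_or {a b i j : ℕ+} (hab : a < b) (hij : i < j) :
    Equiv.swap a b i < Equiv.swap a b j ∨ (i = a ∧ j = b) ∨ (i = a ∧ j < b) ∨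
      (a < i ∧ j = b) := by
  rw [Equiv.swap_apply_def, Equiv.swap_apply_def]
  grind

lemma swapPair_mem_inversions {u : Equiv.Perm ℕ+} {a b : ℕ+} (hab : a < b) (hu : u a < u b)
    {q : ℕ+ × ℕ+} (hq : q ∈ inversions u) :
    swapPair a b q ∈ inversions (u * Equiv.swap a b) := by
  obtain ⟨i, j⟩ := q
  obtain ⟨hij, hinv⟩ := hq
  dsimp only at hij hinv
  by_cases h : Equiv.swap a b i < Equiv.swap a b j
  · simp [swapPair, inversions, h, hinv]
  · simp only [swapPair, h, if_false, inversions, Set.mem_ofPred_eq, Equiv.Perm.mul_apply, hij,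
      true_and]
    rcases swap_lt_swap_or hab hij with h' | ⟨rfl, rfl⟩ | ⟨rfl, hj⟩ | ⟨hi, rfl⟩
    · exact absurd h' h
    · exact absurd hinv hu.asymm
    · rw [Equiv.swap_apply_left, Equiv.swap_apply_of_ne_of_ne hij.ne' hj.ne]
      exact hinv.trans hu
    · rw [Equiv.swap_apply_right, Equiv.swap_apply_of_ne_of_ne hi.ne' hij.ne]
      exact hu.trans hinv

lemma left_notMem_swapPair_image {u : Equiv.Perm ℕ+} {a b c : ℕ+} (hac : a < c) (hcb : c ≤ b)
    (hu : u a < u c) : (a, c) ∉ swapPair a b '' inversions u := by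
  rintro ⟨q, hq, h⟩
  have h' := swapPair_swapPair (a := a) (b := b) hq.1
  rw [h] at h'
  have e : swapPair a b (a, c) = (a, c) := by
    rcases hcb.lt_or_eq with hcb | rfl
    · simp [swapPair, Equiv.swap_apply_of_ne_of_ne hac.ne' hcb.ne, hcb.not_gt]
    · simp [swapPair, hac.not_gt]
  rw [e] at h'
  rw [← h'] at hq
  exact hu.asymm hq.2

lemma insert_swapPair_image_subset {u : Equiv.Perm ℕ+} {a b : ℕ+} (hab : a < b)
    (hu : u a < u b) :
    insert (a, b) (swapPair a b '' inversions u) ⊆ inversions (u * Equiv.swap a b) := by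
  rintro q (rfl | ⟨r, hr, rfl⟩)
  · simp [inversions, hab, hu]
  · exact swapPair_mem_inversions hab hu hr

lemma ncard_insert_swapPair_image {u : Equiv.Perm ℕ+} {a b : ℕ+} (hfin : (inversions u).Finite)
    (hab : a < b) (hu : u a < u b) :
    (insert (a, b) (swapPair a b '' inversions u)).ncard = len u + 1 := by
  rw [Set.ncard_insert_of_notMem (left_notMem_swapPair_image hab le_rfl hu) (hfin.image _),
    (swapPair_injOn a b u).ncard_image]
  rfl

lemma inversions_mul_swap {u : Equiv.Perm ℕ+} {a b : ℕ+} (hab : a < b) (hu : u a < u b)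
    (hc : ∀ c, a < c → c < b → ¬ (u a < u c ∧ u c < u b)) :
    inversions (u * Equiv.swap a b) = insert (a, b) (swapPair a b '' inversions u) := by
  refine Set.Subset.antisymm ?_ (insert_swapPair_image_subset hab hu)
  rintro ⟨i, j⟩ ⟨hij, hinv⟩
  simp only [Equiv.Perm.mul_apply] at hij hinv
  by_cases h : Equiv.swap a b i < Equiv.swap a b j
  · exact Or.inr ⟨(Equiv.swap a b i, Equiv.swap a b j), ⟨h, hinv⟩, by simp [swapPair, hij]⟩
  · have key : u j < u i → (i, j) ∈ insert (a, b) (swapPair a b '' inversions u) :=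
      fun hlt => Or.inr ⟨(i, j), ⟨hij, hlt⟩, by simp [swapPair, h]⟩
    rcases swap_lt_swap_or hab hij with h' | ⟨rfl, rfl⟩ | ⟨rfl, hj⟩ | ⟨hi, rfl⟩
    · exact absurd h' h
    · exact Or.inl rfl
    · rw [Equiv.swap_apply_left, Equiv.swap_apply_of_ne_of_ne hij.ne' hj.ne] at hinv
      apply key
      exact lt_of_le_of_ne (not_lt.1 fun hlt => hc j hij hj ⟨hlt, hinv⟩)
        (u.injective.ne hij.ne')
    · rw [Equiv.swap_apply_right, Equiv.swap_apply_of_ne_of_ne hi.ne' hij.ne] at hinv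
      apply key
      exact lt_of_le_of_ne (not_lt.1 fun hlt => hc i hi hij ⟨hinv, hlt⟩)
        (u.injective.ne hij.ne')

/-- The cover relation of the `k`-Bruhat order, described without lengths. -/
def kCover (k : ℕ) (u w : Equiv.Perm ℕ+) : Prop :=
  ∃ a b : ℕ+, (a : ℕ) ≤ k ∧ k < (b : ℕ) ∧ w = u * Equiv.swap a b ∧ u a < u b ∧
    ∀ c, a < c → c < b → ¬ (u a < u c ∧ u c < u b)

lemma kBruhatCover.finite_inversions {k : ℕ} {u w : Equiv.Perm ℕ+} (h : kBruhatCover k u w) :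
    (inversions w).Finite := by
  obtain ⟨a, b, -, -, -, hl⟩ := h
  apply Set.finite_of_ncard_ne_zero
  change len w ≠ 0
  omega

lemma kBruhatCover.kCover {k : ℕ} {u w : Equiv.Perm ℕ+} (hfin : (inversions u).Finite)
    (h : kBruhatCover k u w) : kCover k u w := by
  have hw := h.finite_inversions
  obtain ⟨a, b, ha, hb, rfl, hl⟩ := h
  have hab : a < b := PNat.coe_lt_coe _ _ |>.1 (ha.trans_lt hb)
  have hu : u a < u b := by
    by_contra hu
    have hu' : (u * Equiv.swap a b) a < (u * Equiv.swap a b) b := by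
      simpa using lt_of_le_of_ne (not_lt.1 hu) (u.injective.ne hab.ne')
    have hsub := insert_swapPair_image_subset hab hu'
    rw [mul_assoc, Equiv.swap_mul_self, mul_one] at hsub
    have := Set.ncard_le_ncard hsub hfin
    rw [ncard_insert_swapPair_image hw hab hu'] at this
    change _ ≤ len u at this
    omega
  refine ⟨a, b, ha, hb, rfl, hu, fun c hac hcb hc => ?_⟩
  have hmem : (a, c) ∈ inversions (u * Equiv.swap a b) := by
    simp [inversions, hac, Equiv.swap_apply_of_ne_of_ne hac.ne' hcb.ne, hc.2]
  have hnot : (a, c) ∉ insert (a, b) (swapPair a b '' inversions u) := by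
    rintro (h | h)
    · exact hcb.ne (Prod.ext_iff.1 h).2
    · exact left_notMem_swapPair_image hac hcb.le hc.1 h
  have := Set.ncard_le_ncard
    (Set.insert_subset hmem (insert_swapPair_image_subset hab hu)) hw
  rw [Set.ncard_insert_of_notMem hnot ((hfin.image _).insert _),
    ncard_insert_swapPair_image hfin hab hu] at this
  change _ ≤ len (u * Equiv.swap a b) at this
  omega

lemma kCover.kBruhatCover {k : ℕ} {u w : Equiv.Perm ℕ+} (hfin : (inversions u).Finite)
    (h : kCover k u w) : kBruhatCover k u w := by
  obtain ⟨a, b, ha, hb, rfl, hu, hc⟩ := h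
  have hab : a < b := PNat.coe_lt_coe _ _ |>.1 (ha.trans_lt hb)
  refine ⟨a, b, ha, hb, rfl, ?_⟩
  rw [← ncard_insert_swapPair_image hfin hab hu, ← inversions_mul_swap hab hu hc]
  rfl

/-- The reflexive–transitive closure of `kCover k`. -/
def kLE (k : ℕ) : Equiv.Perm ℕ+ → Equiv.Perm ℕ+ → Prop :=
  Relation.ReflTransGen (kCover k)

lemma kBruhatLE.finite_inversions {k : ℕ} {u w : Equiv.Perm ℕ+} (hfin : (inversions u).Finite)
    (h : kBruhatLE k u w) : (inversions w).Finite := by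
  induction h with
  | refl => exact hfin
  | tail _ h _ => exact h.finite_inversions

lemma kBruhatLE_iff {k : ℕ} {u w : Equiv.Perm ℕ+} (hfin : (inversions u).Finite) :
    kBruhatLE k u w ↔ kLE k u w := by
  constructor
  · intro h
    induction h with
    | refl => exact .refl
    | tail h hc ih => exact ih.tail (hc.kCover (kBruhatLE.finite_inversions hfin h))
  · intro h
    induction h with
    | refl => exact .refl
    | tail _ hc ih => exact ih.tail (hc.kBruhatCover (kBruhatLE.finite_inversions hfin ih))

lemma kCover.apply_monotone {k : ℕ} {u w : Equiv.Perm ℕ+} (h : kCover k u w) (i : ℕ+) :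
    ((i : ℕ) ≤ k → u i ≤ w i) ∧ (k < (i : ℕ) → w i ≤ u i) := by
  obtain ⟨a, b, ha, hb, rfl, hu, -⟩ := h
  rw [Equiv.Perm.mul_apply, Equiv.swap_apply_def]
  split_ifs with h1 h2
  · subst h1
    exact ⟨fun _ => hu.le, fun h => absurd ha h.not_ge⟩
  · subst h2
    exact ⟨fun h => absurd hb h.not_gt, fun _ => hu.le⟩
  · exact ⟨fun _ => le_rfl, fun _ => le_rfl⟩

lemma kLE.apply_monotone {k : ℕ} {u w : Equiv.Perm ℕ+} (h : kLE k u w) (i : ℕ+) :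
    ((i : ℕ) ≤ k → u i ≤ w i) ∧ (k < (i : ℕ) → w i ≤ u i) := by
  induction h with
  | refl => exact ⟨fun _ => le_rfl, fun _ => le_rfl⟩
  | tail _ hc ih =>
    exact ⟨fun hi => (ih.1 hi).trans ((hc.apply_monotone i).1 hi),
      fun hi => ((hc.apply_monotone i).2 hi).trans (ih.2 hi)⟩

lemma kCover.apply_lt {k : ℕ} {u w : Equiv.Perm ℕ+} (h : kCover k u w) {c d : ℕ+} (hcd : c < d)
    (hk : (d : ℕ) ≤ k ∨ k < (c : ℕ)) (hu : u c < u d) : w c < w d := by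
  obtain ⟨a, b, ha, hb, rfl, hab, hbt⟩ := h
  have inj : ∀ {i j}, u i = u j → i = j := fun h => u.injective h
  have hcd' := PNat.coe_lt_coe _ _ |>.2 hcd
  rw [Equiv.Perm.mul_apply, Equiv.Perm.mul_apply, Equiv.swap_apply_def, Equiv.swap_apply_def]
  rcases hk with hk | hk
  · have hcb : c ≠ b := by rintro rfl; omega
    have hdb : d ≠ b := by rintro rfl; omega
    have hdb' : d < b := PNat.coe_lt_coe _ _ |>.1 (hk.trans_lt hb)
    rw [if_neg hcb, if_neg hdb]
    split_ifs with h1 h2 h2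
    · exact absurd (h1.trans h2.symm) hcd.ne
    · subst h1
      exact lt_of_le_of_ne (not_lt.1 fun h => hbt d hcd hdb' ⟨hu, h⟩) fun e => hdb (inj e).symm
    · subst h2
      exact hu.trans hab
    · exact hu
  · have hca : c ≠ a := by rintro rfl; omega
    have hda : d ≠ a := by rintro rfl; omega
    have hac : a < c := PNat.coe_lt_coe _ _ |>.1 (ha.trans_lt hk)
    rw [if_neg hca, if_neg hda]
    split_ifs with h1 h2 h2
    · exact absurd (h1.trans h2.symm) hcd.ne
    · subst h1
      exact hab.trans hu
    · subst h2
      exact lt_of_le_of_ne (not_lt.1 fun h => hbt c hac hcd ⟨h, hu⟩) fun e => hca (inj e)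
    · exact hu

lemma kLE.apply_lt {k : ℕ} {u w : Equiv.Perm ℕ+} (h : kLE k u w) {c d : ℕ+} (hcd : c < d)
    (hk : (d : ℕ) ≤ k ∨ k < (c : ℕ)) (hu : u c < u d) : w c < w d := by
  induction h with
  | refl => exact hu
  | tail _ hc ih => exact hc.apply_lt hcd hk ih

lemma kLE.apply_eq_of_mem {k : ℕ} {x v z : Equiv.Perm ℕ+} {p : ℕ+} (hxv : kLE k x v)
    (hvz : kLE k v z) (hfix : x p = z p) : v p = x p := by
  rcases le_or_gt (p : ℕ) k with h | h
  · exact le_antisymm (hfix ▸ (hvz.apply_monotone p).1 h) ((hxv.apply_monotone p).1 h)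
  · exact le_antisymm ((hxv.apply_monotone p).2 h) (hfix ▸ (hvz.apply_monotone p).2 h)

section Deletion

variable {k k' : ℕ} {p : ℕ+} {D : Equiv.Perm ℕ+ → Equiv.Perm ℕ+}

lemma eq_of_deletion_eq (hD : ∀ v, isDel p v (D v)) {v v' : Equiv.Perm ℕ+}
    (hp : v p = v' p) (h : D v = D v') : v = v' := by
  ext1 j
  by_cases hj : j = p
  · rw [hj, hp]
  · obtain ⟨i, rfl⟩ := exists_skip_eq hj
    rw [(hD v).apply_skip, (hD v').apply_skip, hp, h]

lemma deletion_mul_swap (hD : ∀ v, isDel p v (D v)) (u : Equiv.Perm ℕ+) (a b : ℕ+) :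
    D (u * Equiv.swap (skip p a) (skip p b)) = D u * Equiv.swap a b := by
  ext1 i
  apply (skip_strictMono (u p)).injective
  have hp : (u * Equiv.swap (skip p a) (skip p b)) p = u p := by
    rw [Equiv.Perm.mul_apply, Equiv.swap_apply_of_ne_of_ne (skip_ne p a).symm (skip_ne p b).symm]
  have h := (hD (u * Equiv.swap (skip p a) (skip p b))).apply_skip i
  rw [hp] at h
  rw [← h, Equiv.Perm.mul_apply, Equiv.Perm.mul_apply, ← (hD u).apply_skip,
    (skip_strictMono p).injective.map_swap]

lemma inversions_deletion_finite (hD : ∀ v, isDel p v (D v)) {u : Equiv.Perm ℕ+}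
    (hfin : (inversions u).Finite) : (inversions (D u)).Finite := by
  have hinj := (skip_strictMono p).injective
  refine (hfin.preimage (f := Prod.map (skip p) (skip p)) (hinj.prodMap hinj).injOn).subset ?_
  rintro ⟨i, j⟩ ⟨hij, hinv⟩
  refine ⟨skip_strictMono p hij, ?_⟩
  dsimp only [Prod.map]
  rw [(hD u).apply_skip, (hD u).apply_skip]
  exact skip_strictMono (u p) hinv

lemma kCover.deletion (hk' : k' = if k < (p : ℕ) then k else k - 1)
    (hD : ∀ v, isDel p v (D v)) {u w : Equiv.Perm ℕ+} (h : kCover k u w) (hp : w p = u p) :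
    kCover k' (D u) (D w) := by
  obtain ⟨a, b, ha, hb, rfl, hu, hc⟩ := h
  have hap : a ≠ p := by
    rintro rfl
    rw [Equiv.Perm.mul_apply, Equiv.swap_apply_left] at hp
    exact hu.ne' hp
  have hbp : b ≠ p := by
    rintro rfl
    rw [Equiv.Perm.mul_apply, Equiv.swap_apply_right] at hp
    exact hu.ne hp
  obtain ⟨a, rfl⟩ := exists_skip_eq hap
  obtain ⟨b, rfl⟩ := exists_skip_eq hbp
  refine ⟨a, b, (coe_skip_le_iff hk' a).1 ha, not_le.1 fun h => hb.not_ge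
    ((coe_skip_le_iff hk' b).2 h), deletion_mul_swap hD u a b, ?_, fun c hac hcb h => ?_⟩
  · rwa [(hD u).apply_skip, (hD u).apply_skip, (skip_strictMono _).lt_iff_lt] at hu
  · apply hc (skip p c) (skip_strictMono p hac) (skip_strictMono p hcb)
    simp only [(hD u).apply_skip, (skip_strictMono _).lt_iff_lt]
    exact h

lemma kLE.deletion (hk' : k' = if k < (p : ℕ) then k else k - 1)
    (hD : ∀ v, isDel p v (D v)) {u w : Equiv.Perm ℕ+} (h : kLE k u w) (hp : u p = w p) :
    kLE k' (D u) (D w) := by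
  induction h using Relation.ReflTransGen.head_induction_on with
  | refl => exact .refl
  | head hc h ih =>
    have e := kLE.apply_eq_of_mem (.single hc) h hp
    exact (ih (e.trans hp)).head (hc.deletion hk' hD e)

lemma kCover.exists_lift (hk' : k' = if k < (p : ℕ) then k else k - 1)
    (hD : ∀ v, isDel p v (D v)) {x z u w' : Equiv.Perm ℕ+} (hxz : kLE k x z) (hfix : x p = z p)
    (hu : u p = x p) (hxu : kLE k' (D x) (D u)) (h : kCover k' (D u) w')
    (hwz : kLE k' w' (D z)) : ∃ w, kCover k u w ∧ w p = x p ∧ D w = w' := by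
  obtain ⟨a, b, ha, hb, rfl, hlt, hc⟩ := h
  have ha' := (coe_skip_le_iff hk' a).2 ha
  have hb' : k < (skip p b : ℕ) := not_le.1 fun h => hb.not_ge ((coe_skip_le_iff hk' b).1 h)
  refine ⟨u * Equiv.swap (skip p a) (skip p b), ⟨skip p a, skip p b, ha', hb', rfl, ?_, ?_⟩, ?_,
    deletion_mul_swap hD u a b⟩
  · rwa [(hD u).apply_skip, (hD u).apply_skip, (skip_strictMono _).lt_iff_lt]
  · intro c hac hcb h
    by_cases hcp : c = p
    · subst hcp
      simp only [(hD u).apply_skip, hu] at h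
      have mono := (skip_strictMono (x c)).monotone
      rcases le_or_gt (c : ℕ) k with hck | hck
      · have h1 : x (skip c a) < x c := by
          rw [(hD x).apply_skip]
          exact (mono ((hxu.apply_monotone a).1 ha)).trans_lt h.1
        have h2 : z c < z (skip c a) := by
          have hm := (hwz.apply_monotone a).1 ha
          rw [Equiv.Perm.mul_apply, Equiv.swap_apply_left] at hm
          rw [(hD z).apply_skip, ← hfix]
          exact h.2.trans_le (mono hm)
        exact h2.asymm (hxz.apply_lt hac (.inl hck) h1)
      · have h1 : x c < x (skip c b) := by
          rw [(hD x).apply_skip]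
          exact h.2.trans_le (mono ((hxu.apply_monotone b).2 hb))
        have h2 : z (skip c b) < z c := by
          have hm := (hwz.apply_monotone b).2 hb
          rw [Equiv.Perm.mul_apply, Equiv.swap_apply_right] at hm
          rw [(hD z).apply_skip, ← hfix]
          exact (mono hm).trans_lt h.1
        exact h2.asymm (hxz.apply_lt hcb (.inr hck) h1)
    · obtain ⟨c, rfl⟩ := exists_skip_eq hcp
      simp only [(hD u).apply_skip, (skip_strictMono _).lt_iff_lt] at h hac hcb
      exact hc c hac hcb h
  · rw [Equiv.Perm.mul_apply, Equiv.swap_apply_of_ne_of_ne (skip_ne p a).symm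
      (skip_ne p b).symm, hu]

lemma kLE.exists_lift (hk' : k' = if k < (p : ℕ) then k else k - 1)
    (hD : ∀ v, isDel p v (D v)) {x z u w' : Equiv.Perm ℕ+} (hxz : kLE k x z) (hfix : x p = z p)
    (hu : u p = x p) (hxu : kLE k' (D x) (D u)) (h : kLE k' (D u) w')
    (hwz : kLE k' w' (D z)) : ∃ w, kLE k u w ∧ w p = x p ∧ D w = w' := by
  induction h with
  | refl => exact ⟨u, .refl, hu, rfl⟩
  | tail h hc ih =>
    obtain ⟨v, huv, hv, rfl⟩ := ih (hwz.head hc)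
    obtain ⟨w, hvw, hw, rfl⟩ := hc.exists_lift hk' hD hxz hfix hv (hxu.trans h) hwz
    exact ⟨w, huv.tail hvw, hw, rfl⟩

lemma kLE.of_deletion (hk' : k' = if k < (p : ℕ) then k else k - 1)
    (hD : ∀ v, isDel p v (D v)) {x z v v' : Equiv.Perm ℕ+} (hxz : kLE k x z) (hfix : x p = z p)
    (hv : v p = x p) (hv' : v' p = x p) (hxv : kLE k' (D x) (D v)) (h : kLE k' (D v) (D v'))
    (hvz : kLE k' (D v') (D z)) : kLE k v v' := by
  obtain ⟨w, hvw, hw, e⟩ := hxz.exists_lift hk' hD hfix hv hxv h hvz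
  rwa [eq_of_deletion_eq hD (hw.trans hv'.symm) e] at hvw

lemma mul_inv_eq_of_isEps (hD : ∀ v, isDel p v (D v)) {x z w' : Equiv.Perm ℕ+}
    (hfix : x p = z p) (h : isEps (x p) (x p) (D z * (D x)⁻¹) w') : z * x⁻¹ = w' := by
  rw [mul_inv_eq_iff_eq_mul]
  ext1 j
  rw [Equiv.Perm.mul_apply]
  by_cases hj : j = p
  · rw [hj, h.2.1, hfix]
  · obtain ⟨i, rfl⟩ := exists_skip_eq hj
    rw [(hD x).apply_skip, h.apply_skip, (hD z).apply_skip, hfix]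
    simp

end Deletion

/-- Lemma 4.1.1(iv): if `x ≤_k z` and `x(p) = z(p)`, then with
`k' = k` if `k < p` and `k' = k − 1` otherwise, one has `x/_p ≤_{k'} z/_p`,
the map `v ↦ v/_p` is an order isomorphism `[x,z]_k ≅ [x/_p, z/_p]_{k'}`,
and `z∘x⁻¹ = ε_{x(p),x(p)}((z/_p)∘(x/_p)⁻¹)`. -/
theorem stmt18 (k : ℕ) (hk : 0 < k) (p : ℕ+) (x z : Equiv.Perm ℕ+)
    (hx : finSupp x) (hz : finSupp z)
    (hxz : kBruhatLE k x z) (hfix : x p = z p)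
    (k' : ℕ) (hk' : k' = if k < (p : ℕ) then k else k - 1)
    (D : Equiv.Perm ℕ+ → Equiv.Perm ℕ+) (hD : ∀ v, isDel p v (D v)) :
    kBruhatLE k' (D x) (D z) ∧
    Set.BijOn D {v | kBruhatLE k x v ∧ kBruhatLE k v z}
      {v | kBruhatLE k' (D x) v ∧ kBruhatLE k' v (D z)} ∧
    (∀ v v' : Equiv.Perm ℕ+,
      (kBruhatLE k x v ∧ kBruhatLE k v z) → (kBruhatLE k x v' ∧ kBruhatLE k v' z) →
      (kBruhatLE k v v' ↔ kBruhatLE k' (D v) (D v'))) ∧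
    (∀ w' : Equiv.Perm ℕ+, isEps (x p) (x p) (D z * (D x)⁻¹) w' → z * x⁻¹ = w') := by
  have finx := finite_inversions hx
  have finDx := inversions_deletion_finite hD finx
  have interval : ∀ v, (kBruhatLE k x v ∧ kBruhatLE k v z) ↔ (kLE k x v ∧ kLE k v z) :=
    fun v => by
      rw [kBruhatLE_iff finx]
      refine and_congr_right fun h => kBruhatLE_iff ?_
      exact kBruhatLE.finite_inversions finx ((kBruhatLE_iff finx).2 h)
  have interval' : ∀ v, (kBruhatLE k' (D x) v ∧ kBruhatLE k' v (D z)) ↔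
      (kLE k' (D x) v ∧ kLE k' v (D z)) :=
    fun v => by
      rw [kBruhatLE_iff finDx]
      refine and_congr_right fun h => kBruhatLE_iff ?_
      exact kBruhatLE.finite_inversions finDx ((kBruhatLE_iff finDx).2 h)
  rw [kBruhatLE_iff finx] at hxz
  have down : ∀ v, kLE k x v → kLE k v z →
      v p = x p ∧ kLE k' (D x) (D v) ∧ kLE k' (D v) (D z) := fun v h1 h2 => by
    have e := h1.apply_eq_of_mem h2 hfix
    exact ⟨e, h1.deletion hk' hD e.symm, h2.deletion hk' hD (e.trans hfix)⟩
  refine ⟨(kBruhatLE_iff finDx).2 (hxz.deletion hk' hD hfix), ⟨?_, ?_, ?_⟩, ?_,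
    fun w' => mul_inv_eq_of_isEps hD hfix⟩
  · intro v hv
    obtain ⟨h1, h2⟩ := (interval v).1 hv
    exact (interval' _).2 (down v h1 h2).2
  · intro v hv v' hv' e
    obtain ⟨h1, h2⟩ := (interval v).1 hv
    obtain ⟨h1', h2'⟩ := (interval v').1 hv'
    exact eq_of_deletion_eq hD ((down v h1 h2).1.trans (down v' h1' h2').1.symm) e
  · intro v' hv'
    obtain ⟨h1, h2⟩ := (interval' v').1 hv'
    obtain ⟨v, hxv, hv, rfl⟩ := hxz.exists_lift hk' hD hfix rfl .refl h1 h2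
    exact ⟨v, (interval v).2
      ⟨hxv, hxz.of_deletion hk' hD hfix hv hfix.symm h1 h2 .refl⟩, rfl⟩
  · intro v v' hv hv'
    have finv := kBruhatLE.finite_inversions finx hv.1
    obtain ⟨h1, h2⟩ := (interval v).1 hv
    obtain ⟨h1', h2'⟩ := (interval v').1 hv'
    obtain ⟨e, a1, a2⟩ := down v h1 h2
    obtain ⟨e', b1, b2⟩ := down v' h1' h2'
    rw [kBruhatLE_iff finv, kBruhatLE_iff (inversions_deletion_finite hD finv)]
    exact ⟨fun h => h.deletion hk' hD (e.trans e'.symm),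
      fun h => hxz.of_deletion hk' hD hfix e e' a1 h b2⟩
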